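/- Let k ≥ 2, let ρ be a tail function with smoothness parameter β, let 0 < γ ≤ 1/8, let n ≥ 35, T ≥ 1, 0 < η ≤ 1/(6βk), and let ε > 0 satisfy ρ^{−1}(ε/k)² / (η γ² T) ≤ ε ≤ 1/256. Let D be the distribution on ℝ³ × {1,…,k} putting mass (59/64)(1 − 1/n) on ((1,0,0), 1), mass (5/64)(1 − 1/n) on ((−1/2, 3γ, 0), 1), and mass 1/n on ((0, −1/8, 4γ + 1/4), 1). Define φ(x) = ρ(x) for x ≥ 0 and φ(x) = ρ(0) + ρ′(0)x + (β/2)x² for x < 0, and the loss ℓ(ŷ, y) = Σ_{j≠y} φ(ŷ_y − ŷ_j). For an i.i.d. sample S of size n from D, let W_T be the T-th iterate of gradient descent on the empirical risk L̂_S with step size η started from W_1 = 0. Then E_S[L(W_T)] ≥ β k ρ^{−1}(256ε/k)² / (10⁶ γ² n), where L(W) = E_{(x,y)~D}[ℓ(Wx, y)]. -/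

import Mathlib

open Real Filter MeasureTheory Finset
open scoped ENNReal

/-- The `L_p` norm of a vector in `ℝ^m`, for `p ∈ [1,∞]` (as an `ℝ≥0∞` parameter). -/
noncomputable def pnorm (p : ℝ≥0∞) {m : ℕ} (v : Fin m → ℝ) : ℝ :=
  ‖(WithLp.equiv p (Fin m → ℝ)).symm v‖

/-- The gradient of `f : ℝ^m → ℝ`, as the vector of partial derivatives. -/
noncomputable def grad {m : ℕ} (f : (Fin m → ℝ) → ℝ) (w : Fin m → ℝ) : Fin m → ℝ :=
  fun i => fderiv ℝ f w (Pi.single i 1)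

/-- The Frobenius norm of a `k × d` matrix. -/
noncomputable def frob {k d : ℕ} (A : Fin k → Fin d → ℝ) : ℝ :=
  Real.sqrt (∑ i, ∑ j, A i j ^ 2)

/-- The gradient of a function of a `k × d` matrix, as the matrix of partial derivatives. -/
noncomputable def gradM {k d : ℕ} (f : (Fin k → Fin d → ℝ) → ℝ) (W : Fin k → Fin d → ℝ) :
    Fin k → Fin d → ℝ :=
  fun i j => fderiv ℝ f W (Pi.single i (Pi.single j 1))

/-- A tail function `ρ : [0,∞) → ℝ` (with values of `ρ` on negatives irrelevant), together with
its (one-sided) derivative `ρ'`: nonnegative, `1`-Lipschitz, convex, `β`-smooth, strictly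
decreasing, tending to `0` at infinity, with `ρ(0) ≥ 1` and `|ρ'(0)| ≥ 1/2`. -/
structure IsTailFunction (β : ℝ) (ρ ρ' : ℝ → ℝ) : Prop where
  nonneg : ∀ x, 0 ≤ x → 0 ≤ ρ x
  lipschitz : ∀ x, 0 ≤ x → ∀ y, 0 ≤ y → |ρ x - ρ y| ≤ |x - y|
  convexOn : ConvexOn ℝ (Set.Ici (0 : ℝ)) ρ
  hasDeriv : ∀ x, 0 ≤ x → HasDerivWithinAt ρ (ρ' x) (Set.Ici 0) x
  smooth : ∀ x, 0 ≤ x → ∀ y, 0 ≤ y → |ρ' x - ρ' y| ≤ β * |x - y|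
  strictAnti : ∀ x, 0 ≤ x → ∀ y, x < y → ρ y < ρ x
  tendsto_zero : Filter.Tendsto ρ Filter.atTop (nhds 0)
  one_le : 1 ≤ ρ 0
  deriv_zero : 1 / 2 ≤ |ρ' 0|

/-- The inverse of a tail function: for `0 < z ≤ ρ 0`, `tailInv ρ z` is the unique `u ≥ 0` with
`ρ u = z`. -/
noncomputable def tailInv (ρ : ℝ → ℝ) (z : ℝ) : ℝ := sInf {u : ℝ | 0 ≤ u ∧ ρ u ≤ z}

/-- Gradient descent iterates on objective `F` with step size `η`, started from `0`:
`gdFrom η F s` is the iterate after `s` gradient steps (so `W_T = gdFrom η F (T - 1)` when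
iterates are numbered `W_1 = 0, W_2, …`). -/
noncomputable def gdFrom {k d : ℕ} (η : ℝ) (F : (Fin k → Fin d → ℝ) → ℝ) :
    ℕ → (Fin k → Fin d → ℝ)
  | 0 => 0
  | t + 1 => gdFrom η F t - η • gradM F (gdFrom η F t)

/-- The multiclass loss `ℓ(v, y) = Σ_{j ≠ y} φ(v_y - v_j)` built from a univariate function. -/
noncomputable def mcLoss {k : ℕ} (φ : ℝ → ℝ) (v : Fin k → ℝ) (y : Fin k) : ℝ :=
  ∑ j ∈ Finset.univ \ {y}, φ (v y - v j)

/-- The empirical risk of `W` on the sample `S` for the loss `mcLoss φ`. -/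
noncomputable def empRisk {k d n : ℕ} (φ : ℝ → ℝ) (S : Fin n → (Fin d → ℝ) × Fin k)
    (W : Fin k → Fin d → ℝ) : ℝ :=
  (1 / n : ℝ) * ∑ i, mcLoss φ (fun r => ∑ t, W r t * (S i).1 t) (S i).2

/-- tangent line inequality from a monotone derivative -/
lemma tangent_le {f f' : ℝ → ℝ} (hf : ∀ x, HasDerivAt f (f' x) x) (hm : Monotone f') (x y : ℝ) :
    f x + f' x * (y - x) ≤ f y := by
  have hd : deriv f = f' := funext fun x => (hf x).deriv
  have hc : ConvexOn ℝ Set.univ f :=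
    Monotone.convexOn_univ_of_deriv (fun x => (hf x).differentiableAt) (by rw [hd]; exact hm)
  rcases lt_trichotomy x y with h | h | h
  · have := hc.le_slope_of_hasDerivAt (Set.mem_univ x) (Set.mem_univ y) h (hf x)
    rw [slope_def_field, le_div_iff₀ (by linarith)] at this
    linarith
  · subst h; simp
  · have := hc.slope_le_of_hasDerivAt (Set.mem_univ y) (Set.mem_univ x) h (hf x)
    rw [slope_def_field, div_le_iff₀ (by linarith)] at this
    linarith

/-- The properties of the extended loss we need. -/
structure GoodLoss (β : ℝ) (φ φ' : ℝ → ℝ) : Prop where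
  deriv : ∀ x, HasDerivAt φ (φ' x) x
  lower : ∀ x y, φ x + φ' x * (y - x) ≤ φ y
  upper : ∀ x y, φ y ≤ φ x + φ' x * (y - x) + β / 2 * (y - x) ^ 2

lemma tail_mono {β : ℝ} {ρ ρ' : ℝ → ℝ} (hρ : IsTailFunction β ρ ρ') (x y : ℝ) (hx : 0 ≤ x)
    (hxy : x ≤ y) : ρ' x ≤ ρ' y := by
  rcases hxy.eq_or_lt with h | h
  · rw [h]
  have hy : 0 ≤ y := hx.trans hxy
  exact (hρ.convexOn.le_slope_of_hasDerivWithinAt hx hy h (hρ.hasDeriv x hx)).trans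
    (hρ.convexOn.slope_le_of_hasDerivWithinAt hx hy h (hρ.hasDeriv y hy))

lemma tail_deriv_zero {β : ℝ} {ρ ρ' : ℝ → ℝ} (hρ : IsTailFunction β ρ ρ') : ρ' 0 ≤ -(1 / 2) := by
  have h1 := hρ.convexOn.le_slope_of_hasDerivWithinAt (x := 0) (y := 1) (by simp) (by simp)
    one_pos (hρ.hasDeriv 0 le_rfl)
  rw [slope_def_field] at h1
  have h2 := hρ.strictAnti 0 le_rfl 1 one_pos
  have h3 : ρ' 0 < 0 := by norm_num at h1; linarith
  have h4 := hρ.deriv_zero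
  rw [abs_of_neg h3] at h4
  linarith

lemma goodLoss_of_tail {β : ℝ} (hβ : 0 < β) {ρ ρ' : ℝ → ℝ} (hρ : IsTailFunction β ρ ρ')
    {φ : ℝ → ℝ} (hφ : φ = fun x => if 0 ≤ x then ρ x else ρ 0 + ρ' 0 * x + β / 2 * x ^ 2) :
    GoodLoss β φ (fun x => if 0 ≤ x then ρ' x else ρ' 0 + β * x) := by
  have hquad : ∀ x : ℝ, HasDerivAt (fun x => ρ 0 + ρ' 0 * x + β / 2 * x ^ 2) (ρ' 0 + β * x) x := by
    intro x
    have := (((hasDerivAt_id x).const_mul (ρ' 0)).const_add (ρ 0)).add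
      (((hasDerivAt_id x).pow 2).const_mul (β / 2))
    exact this.congr_deriv (by simp; ring)
  have hd : ∀ x, HasDerivAt φ (if 0 ≤ x then ρ' x else ρ' 0 + β * x) x := by
    intro x
    rcases lt_trichotomy x 0 with h | h | h
    · rw [if_neg (not_le.2 h)]
      refine (hquad x).congr_of_eventuallyEq ?_
      filter_upwards [Iio_mem_nhds h] with y hy
      rw [hφ]; simp only; rw [if_neg (not_le.2 hy)]
    · subst h
      rw [if_pos le_rfl]
      have h1 : HasDerivWithinAt φ (ρ' 0) (Set.Ici 0) 0 := by
        refine (hρ.hasDeriv 0 le_rfl).congr ?_ ?_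
        · intro y hy; rw [hφ]; exact if_pos hy
        · rw [hφ]; exact if_pos le_rfl
      have h2 : HasDerivWithinAt φ (ρ' 0) (Set.Iic 0) 0 := by
        have := (hquad 0).hasDerivWithinAt (s := Set.Iic 0)
        rw [mul_zero, add_zero] at this
        refine this.congr ?_ ?_
        · intro y hy; rw [hφ]
          simp only
          split_ifs with h
          · have : y = 0 := le_antisymm hy h
            subst this; simp
          · rfl
        · rw [hφ]; simp
      have := h2.union h1
      rw [Set.Iic_union_Ici] at this
      exact hasDerivWithinAt_univ.1 this
    · rw [if_pos h.le]
      refine ((hρ.hasDeriv x h.le).hasDerivAt (Ici_mem_nhds h)).congr_of_eventuallyEq ?_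
      filter_upwards [Ioi_mem_nhds h] with y hy
      rw [hφ]; exact if_pos (le_of_lt hy)
  have hm : Monotone (fun x => if 0 ≤ x then ρ' x else ρ' 0 + β * x) := by
    intro x y hxy
    simp only
    split_ifs with h1 h2 h2
    · exact tail_mono hρ x y h1 hxy
    · linarith
    · have := tail_mono hρ 0 y le_rfl h2
      nlinarith
    · nlinarith
  have hm2 : Monotone (fun x => β * x - (if 0 ≤ x then ρ' x else ρ' 0 + β * x)) := by
    intro x y hxy
    simp only
    have key : ∀ a b : ℝ, 0 ≤ a → a ≤ b → ρ' b - ρ' a ≤ β * (b - a) := by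
      intro a b ha hab
      have := hρ.smooth b (ha.trans hab) a ha
      rw [abs_of_nonneg (sub_nonneg.2 hab)] at this
      exact (le_abs_self _).trans this
    split_ifs with h1 h2 h2
    · have := key x y h1 hxy
      linarith
    · linarith
    · have := key 0 y le_rfl h2
      linarith
    · linarith
  refine ⟨hd, tangent_le hd hm, ?_⟩
  intro x y
  have hd2 : ∀ x, HasDerivAt (fun x => β / 2 * x ^ 2 - φ x)
      (β * x - (if 0 ≤ x then ρ' x else ρ' 0 + β * x)) x := by
    intro x
    have := (((hasDerivAt_id x).pow 2).const_mul (β / 2)).sub (hd x)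
    exact this.congr_deriv (by simp; ring)
  have := tangent_le hd2 hm2 x y
  linarith

section tail
variable {β : ℝ} {ρ ρ' : ℝ → ℝ} {φ : ℝ → ℝ}

lemma phi_neg (hβ : 0 < β) (hρ : IsTailFunction β ρ ρ')
    (hφ : φ = fun x => if 0 ≤ x then ρ x else ρ 0 + ρ' 0 * x + β / 2 * x ^ 2)
    (x : ℝ) (hx : x ≤ 0) : 1 + β / 2 * x ^ 2 ≤ φ x := by
  have h1 := hρ.one_le
  have h2 := tail_deriv_zero hρ
  rw [hφ]
  simp only
  split_ifs with h
  · have : x = 0 := le_antisymm hx h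
    subst this; simpa using h1
  · nlinarith

lemma phi_nonneg (hβ : 0 < β) (hρ : IsTailFunction β ρ ρ')
    (hφ : φ = fun x => if 0 ≤ x then ρ x else ρ 0 + ρ' 0 * x + β / 2 * x ^ 2)
    (x : ℝ) : 0 ≤ φ x := by
  rcases le_total x 0 with h | h
  · have := phi_neg hβ hρ hφ x h
    have : 0 ≤ β / 2 * x ^ 2 := by positivity
    linarith
  · rw [hφ]; simp only [if_pos h]; exact hρ.nonneg x h

lemma tailInv_le_of_phi (hβ : 0 < β) (hρ : IsTailFunction β ρ ρ')
    (hφ : φ = fun x => if 0 ≤ x then ρ x else ρ 0 + ρ' 0 * x + β / 2 * x ^ 2)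
    (x z : ℝ) (hz : z < 1) (h : φ x ≤ z) : 0 < x ∧ tailInv ρ z ≤ x := by
  have hx : 0 < x := by
    by_contra hc
    have := phi_neg hβ hρ hφ x (not_lt.1 hc)
    have : 0 ≤ β / 2 * x ^ 2 := by positivity
    linarith
  refine ⟨hx, ?_⟩
  refine csInf_le ⟨0, fun u hu => hu.1⟩ ⟨hx.le, ?_⟩
  rw [hφ] at h
  simpa only [if_pos hx.le] using h

lemma tailInv_nonneg (z : ℝ) : 0 ≤ tailInv ρ z :=
  Real.sInf_nonneg fun _ hu => hu.1

lemma tailInv_spec (hρ : IsTailFunction β ρ ρ') (z : ℝ) (hz : 0 < z) : ρ (tailInv ρ z) ≤ z := by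
  have hc : ContinuousOn ρ (Set.Ici 0) := fun x hx => (hρ.hasDeriv x hx).continuousWithinAt
  have hcl : IsClosed {u : ℝ | 0 ≤ u ∧ ρ u ≤ z} := by
    have := hc.preimage_isClosed_of_isClosed isClosed_Ici (isClosed_Iic (a := z))
    exact this
  have hne : {u : ℝ | 0 ≤ u ∧ ρ u ≤ z}.Nonempty := by
    have := (hρ.tendsto_zero.eventually (Iio_mem_nhds hz)).and (eventually_ge_atTop 0)
    obtain ⟨u, h1, h2⟩ := this.exists
    exact ⟨u, h2, le_of_lt h1⟩
  exact (hcl.csInf_mem hne ⟨0, fun u hu => hu.1⟩).2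

end tail

/-- `T` is at least two. -/
lemma two_le_T {k : ℕ} (hk : 2 ≤ k)
    {β : ℝ} (hβ : 0 < β) {ρ ρ' : ℝ → ℝ} (hρ : IsTailFunction β ρ ρ')
    {γ : ℝ} (hγ0 : 0 < γ) (hγ : γ ≤ 1 / 8)
    {T : ℕ} (hT : 1 ≤ T)
    {η : ℝ} (hη0 : 0 < η) (hη : η ≤ 1 / (6 * β * k))
    {ε : ℝ} (hε0 : 0 < ε) (hε1 : ε ≤ 1 / 256)
    (hεT : tailInv ρ (ε / k) ^ 2 / (η * γ ^ 2 * T) ≤ ε) : 2 ≤ T := by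
  by_contra hc
  have hT1 : T = 1 := by omega
  subst hT1
  have hk' : (2 : ℝ) ≤ k := by exact_mod_cast hk
  have hz : 0 < ε / k := by positivity
  have hz1 : ε / k ≤ 1 / 512 := by
    rw [div_le_iff₀ (by positivity)]; nlinarith
  set R := tailInv ρ (ε / k) with hR
  have hR0 : 0 ≤ R := tailInv_nonneg _
  have hs := tailInv_spec hρ _ hz
  rw [← hR] at hs
  have hl := hρ.lipschitz 0 le_rfl R hR0
  rw [zero_sub, abs_neg, abs_of_nonneg hR0] at hl
  have hl' := (le_abs_self _).trans hl
  have h1 := hρ.one_le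
  have hg := goodLoss_of_tail hβ hρ rfl
  have hu := hg.upper 0 (1 / (2 * β))
  have hnn := phi_nonneg hβ hρ rfl (1 / (2 * β))
  have hd := tail_deriv_zero hρ
  have hpos : (0:ℝ) ≤ 1 / (2 * β) := by positivity
  have h3 : 1 / (8 * β) ≤ ρ 0 := by
    have hu' := hnn.trans hu
    simp only [le_refl, if_true, sub_zero] at hu'
    have e1 : β / 2 * (1 / (2 * β)) ^ 2 = 1 / (8 * β) := by field_simp; norm_num
    have e2 : 1 / (2 * β) = 4 * (1 / (8 * β)) := by field_simp; norm_num
    rw [e1] at hu'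
    rw [e2] at hu' hpos
    nlinarith
  have h4 : R ^ 2 ≤ ε * (η * γ ^ 2) := by
    rw [div_le_iff₀ (by positivity)] at hεT
    simpa using hεT
  have h5 : η ≤ 2 / 3 * ρ 0 := by
    calc η ≤ 1 / (6 * β * k) := hη
      _ ≤ 1 / (6 * β * 2) := by gcongr
      _ = 2 / 3 * (1 / (8 * β)) := by field_simp; norm_num
      _ ≤ _ := by linarith
  have h6 : γ ^ 2 ≤ 1 := by nlinarith
  have h7 : ε * (η * γ ^ 2) ≤ 1 / 256 * (2 / 3 * ρ 0 * 1) := by gcongr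
  nlinarith

/-- reduced objective -/
noncomputable def redF {n d : ℕ} (φ : ℝ → ℝ) (x : Fin n → Fin d → ℝ) (u : Fin d → ℝ) : ℝ :=
  (1 / n : ℝ) * ∑ i, φ (u ⬝ᵥ x i)

/-- reduced gradient -/
noncomputable def redG {n d : ℕ} (φ' : ℝ → ℝ) (x : Fin n → Fin d → ℝ) (u : Fin d → ℝ) :
    Fin d → ℝ :=
  fun c => (1 / n : ℝ) * ∑ i, φ' (u ⬝ᵥ x i) * x i c

/-- reduced gradient descent -/
noncomputable def redGD {n d : ℕ} (φ' : ℝ → ℝ) (x : Fin n → Fin d → ℝ) (s : ℝ) : ℕ → Fin d → ℝ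
  | 0 => 0
  | t + 1 => redGD φ' x s t - s • redG φ' x (redGD φ' x s t)

lemma redG_dot {n d : ℕ} (φ' : ℝ → ℝ) (x : Fin n → Fin d → ℝ) (u w : Fin d → ℝ) :
    redG φ' x u ⬝ᵥ w = (1 / n : ℝ) * ∑ i, φ' (u ⬝ᵥ x i) * (w ⬝ᵥ x i) := by
  simp only [redG, dotProduct, Finset.mul_sum, Finset.sum_mul]
  rw [Finset.sum_comm]
  refine Finset.sum_congr rfl fun i _ => Finset.sum_congr rfl fun c _ => ?_
  ring

lemma redF_lower {n d : ℕ} {β : ℝ} {φ φ' : ℝ → ℝ} (h : GoodLoss β φ φ') (x : Fin n → Fin d → ℝ)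
    (u v : Fin d → ℝ) : redF φ x u + redG φ' x u ⬝ᵥ (v - u) ≤ redF φ x v := by
  rw [redG_dot, redF, redF, ← mul_add, ← Finset.sum_add_distrib]
  refine mul_le_mul_of_nonneg_left (Finset.sum_le_sum fun i _ => ?_) (by positivity)
  rw [sub_dotProduct]
  exact h.lower _ _

lemma redF_upper {n d : ℕ} (hn : 0 < n) {β : ℝ} (hβ : 0 < β) {φ φ' : ℝ → ℝ} (h : GoodLoss β φ φ')
    (x : Fin n → Fin d → ℝ)
    (hx : ∀ i, x i ⬝ᵥ x i ≤ 1) (u v : Fin d → ℝ) :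
    redF φ x v ≤ redF φ x u + redG φ' x u ⬝ᵥ (v - u) + β / 2 * ((v - u) ⬝ᵥ (v - u)) := by
  have hn' : (0 : ℝ) < n := by exact_mod_cast hn
  have e : β / 2 * ((v - u) ⬝ᵥ (v - u)) =
      (1 / n : ℝ) * ∑ i : Fin n, β / 2 * ((v - u) ⬝ᵥ (v - u)) := by
    rw [Finset.sum_const, Finset.card_univ, Fintype.card_fin, nsmul_eq_mul]
    field_simp
  rw [e, redG_dot, redF, redF, ← mul_add, ← Finset.sum_add_distrib, ← mul_add,
    ← Finset.sum_add_distrib]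
  refine mul_le_mul_of_nonneg_left (Finset.sum_le_sum fun i _ => ?_) (by positivity)
  have h1 := h.upper (u ⬝ᵥ x i) (v ⬝ᵥ x i)
  rw [← sub_dotProduct] at h1
  have h2 : ((v - u) ⬝ᵥ x i) ^ 2 ≤ (v - u) ⬝ᵥ (v - u) := by
    have := Finset.sum_mul_sq_le_sq_mul_sq Finset.univ (v - u) (x i)
    have e1 : ∀ w : Fin d → ℝ, ∑ i, w i ^ 2 = w ⬝ᵥ w := by
      intro w; simp [dotProduct, pow_two]
    rw [e1, e1] at this
    have h0 : 0 ≤ (v - u) ⬝ᵥ (v - u) := by rw [← e1]; positivity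
    calc _ ≤ _ := this
      _ ≤ (v - u) ⬝ᵥ (v - u) * 1 := by gcongr; exact hx i
      _ = _ := mul_one _
  have h3 : β / 2 * ((v - u) ⬝ᵥ x i) ^ 2 ≤ β / 2 * ((v - u) ⬝ᵥ (v - u)) := by gcongr
  linarith

lemma redF_descent {n d : ℕ} (hn : 0 < n) {β : ℝ} (hβ : 0 < β) {φ φ' : ℝ → ℝ}
    (h : GoodLoss β φ φ') (x : Fin n → Fin d → ℝ)
    (hx : ∀ i, x i ⬝ᵥ x i ≤ 1) (s : ℝ) (hs : 0 < s) (hsβ : s * β ≤ 1) (u : Fin d → ℝ) :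
    redF φ x (u - s • redG φ' x u) ≤ redF φ x u - s / 2 * (redG φ' x u ⬝ᵥ redG φ' x u) := by
  have h1 := redF_upper hn hβ h x hx u (u - s • redG φ' x u)
  set g := redG φ' x u
  have e : u - s • g - u = (-s) • g := by rw [neg_smul]; abel
  rw [e] at h1
  simp only [dotProduct_smul, smul_dotProduct, smul_eq_mul] at h1
  have h0 : 0 ≤ g ⬝ᵥ g := by
    simp only [dotProduct]; exact Finset.sum_nonneg fun i _ => mul_self_nonneg _
  have : s * (s * β) * (g ⬝ᵥ g) ≤ s * 1 * (g ⬝ᵥ g) := by gcongr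
  linarith

lemma redGD_conv {n d : ℕ} (hn : 0 < n) {β : ℝ} (hβ : 0 < β) {φ φ' : ℝ → ℝ}
    (h : GoodLoss β φ φ') (x : Fin n → Fin d → ℝ)
    (hx : ∀ i, x i ⬝ᵥ x i ≤ 1) (s : ℝ) (hs : 0 < s) (hsβ : s * β ≤ 1) (v : Fin d → ℝ) (t : ℕ) :
    (redGD φ' x s t - v) ⬝ᵥ (redGD φ' x s t - v)
      + 2 * s * t * (redF φ x (redGD φ' x s t) - redF φ x v) ≤ v ⬝ᵥ v := by
  induction t with
  | zero => simp [redGD]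
  | succ t ih =>
    rw [redGD]
    set u := redGD φ' x s t
    have h1 := redF_descent hn hβ h x hx s hs hsβ u
    have h2 := redF_lower h x u v
    set g := redG φ' x u
    have h0 : 0 ≤ g ⬝ᵥ g := by
      simp only [dotProduct]; exact Finset.sum_nonneg fun i _ => mul_self_nonneg _
    have e : (u - s • g - v) ⬝ᵥ (u - s • g - v)
        = (u - v) ⬝ᵥ (u - v) + 2 * s * (g ⬝ᵥ (v - u)) + s ^ 2 * (g ⬝ᵥ g) := by
      simp only [sub_dotProduct, dotProduct_sub, dotProduct_smul, smul_dotProduct, smul_eq_mul]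
      rw [dotProduct_comm u g, dotProduct_comm v g]
      ring
    rw [e]
    push_cast
    set a := redF φ x (u - s • g)
    set b := redF φ x u
    set c := redF φ x v
    have h3 : 2 * s * (g ⬝ᵥ (v - u)) ≤ 2 * s * (c - b) := by gcongr; linarith
    have h4 : 2 * s * (t + 1 : ℝ) * (a - c) ≤
        2 * s * (t + 1 : ℝ) * (b - c) - s ^ 2 * (g ⬝ᵥ g) := by
      have h5 : 2 * s * (t + 1 : ℝ) * a ≤ 2 * s * (t + 1 : ℝ) * (b - s / 2 * (g ⬝ᵥ g)) := by gcongr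
      have h6 : 0 ≤ s ^ 2 * t * (g ⬝ᵥ g) := by positivity
      nlinarith
    nlinarith

lemma redGD_zero {n d : ℕ} (φ' : ℝ → ℝ) (x : Fin n → Fin d → ℝ) (c : Fin d) (hx : ∀ i, x i c = 0)
    (s : ℝ) (t : ℕ) : redGD φ' x s t c = 0 := by
  induction t with
  | zero => rfl
  | succ t ih => simp [redGD, redG, ih, hx]

/-- margin functional -/
noncomputable def marg {k d : ℕ} [NeZero k] (x : Fin d → ℝ) (j : Fin k) :
    (Fin k → Fin d → ℝ) →L[ℝ] ℝ :=
  LinearMap.toContinuousLinearMap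
    { toFun := fun W => W 0 ⬝ᵥ x - W j ⬝ᵥ x
      map_add' := by intro A B; simp only [Pi.add_apply, add_dotProduct]; ring
      map_smul' := by
        intro c A; simp only [Pi.smul_apply, smul_dotProduct, smul_eq_mul, RingHom.id_apply]; ring }

lemma marg_apply {k d : ℕ} [NeZero k] (x : Fin d → ℝ) (j : Fin k) (W : Fin k → Fin d → ℝ) :
    marg x j W = W 0 ⬝ᵥ x - W j ⬝ᵥ x := rfl

lemma marg_single {k d : ℕ} [NeZero k] (x : Fin d → ℝ) (j r : Fin k) (c : Fin d) :
    marg x j (Pi.single r (Pi.single c 1)) =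
      (if r = 0 then x c else 0) - (if r = j then x c else 0) := by
  have : ∀ i : Fin k, (Pi.single r (Pi.single c 1) : Fin k → Fin d → ℝ) i ⬝ᵥ x
      = if r = i then x c else 0 := by
    intro i
    split_ifs with h
    · subst h; simp
    · rw [Pi.single_eq_of_ne (Ne.symm h)]; simp
  rw [marg_apply, this, this]

lemma empRisk_gradM {k d n : ℕ} [NeZero k] {β : ℝ} {φ φ' : ℝ → ℝ} (h : GoodLoss β φ φ')
    (S : Fin n → (Fin d → ℝ) × Fin k) (hS : ∀ i, (S i).2 = 0) (W : Fin k → Fin d → ℝ)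
    (r : Fin k) (c : Fin d) :
    gradM (empRisk φ S) W r c = (1 / n : ℝ) * ∑ i, ∑ j ∈ Finset.univ \ {0},
      φ' (W 0 ⬝ᵥ (S i).1 - W j ⬝ᵥ (S i).1) *
        ((if r = 0 then (S i).1 c else 0) - (if r = j then (S i).1 c else 0)) := by
  have e : empRisk φ S = fun W => (1 / n : ℝ) * ∑ i, ∑ j ∈ Finset.univ \ {0},
      φ (marg (S i).1 j W) := by
    funext W
    simp only [empRisk, mcLoss, hS]
    rfl
  have hd : HasFDerivAt (empRisk φ S) ((1 / n : ℝ) • ∑ i, ∑ j ∈ Finset.univ \ {0},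
      φ' (marg (S i).1 j W) • (marg (S i).1 j : (Fin k → Fin d → ℝ) →L[ℝ] ℝ)) W := by
    rw [e]
    refine HasFDerivAt.const_mul ?_ _
    refine HasFDerivAt.fun_sum fun i _ => HasFDerivAt.fun_sum fun j _ => ?_
    exact (h.deriv _).comp_hasFDerivAt W (marg (S i).1 j).hasFDerivAt
  rw [gradM, hd.fderiv]
  simp only [_root_.smul_apply, _root_.sum_apply, marg_single, smul_eq_mul]
  simp only [marg_apply]

lemma gd_reduce {k d n : ℕ} [NeZero k] {β : ℝ} {φ φ' : ℝ → ℝ} (h : GoodLoss β φ φ')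
    (S : Fin n → (Fin d → ℝ) × Fin k) (hS : ∀ i, (S i).2 = 0) (η : ℝ) (t : ℕ) (j : Fin k)
    (hj : j ≠ 0) :
    gdFrom η (empRisk φ S) t 0 - gdFrom η (empRisk φ S) t j
      = redGD φ' (fun i => (S i).1) (k * η) t := by
  induction t generalizing j with
  | zero => simp [gdFrom, redGD]
  | succ t ih =>
    rw [gdFrom, redGD]
    set W := gdFrom η (empRisk φ S) t
    set u := redGD φ' (fun i => (S i).1) (k * η) t
    have hW : ∀ i, ∀ j ∈ (Finset.univ \ {0} : Finset (Fin k)),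
        W 0 ⬝ᵥ (S i).1 - W j ⬝ᵥ (S i).1 = u ⬝ᵥ (S i).1 := by
      intro i j hj
      rw [← sub_dotProduct, ih j (by simpa using hj)]
    have hcard : ((Finset.univ \ {0} : Finset (Fin k)).card : ℝ) = k - 1 := by
      rw [Finset.card_sdiff_of_subset (by simp)]
      have : 1 ≤ k := Nat.one_le_iff_ne_zero.2 (NeZero.ne k)
      simp [Nat.cast_sub this]
    have g0 : gradM (empRisk φ S) W 0 = (k - 1 : ℝ) • redG φ' (fun i => (S i).1) u := by
      funext c
      rw [empRisk_gradM h S hS]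
      have : ∀ i, ∑ j ∈ Finset.univ \ {0},
          φ' (W 0 ⬝ᵥ (S i).1 - W j ⬝ᵥ (S i).1) *
          ((if (0 : Fin k) = 0 then (S i).1 c else 0) - (if 0 = j then (S i).1 c else 0))
          = (k - 1 : ℝ) * (φ' (u ⬝ᵥ (S i).1) * (S i).1 c) := by
        intro i
        rw [← hcard, ← nsmul_eq_mul, ← Finset.sum_const]
        refine Finset.sum_congr rfl fun j hj => ?_
        rw [hW i j hj, if_pos rfl, if_neg (by rintro rfl; simp at hj), sub_zero]
      rw [Finset.sum_congr rfl (fun i _ => this i), ← Finset.mul_sum]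
      simp only [Pi.smul_apply, redG, smul_eq_mul]
      ring
    have gj : gradM (empRisk φ S) W j = - redG φ' (fun i => (S i).1) u := by
      funext c
      rw [empRisk_gradM h S hS]
      have : ∀ i, ∑ j' ∈ Finset.univ \ {0},
          φ' (W 0 ⬝ᵥ (S i).1 - W j' ⬝ᵥ (S i).1) *
          ((if j = 0 then (S i).1 c else 0) - (if j = j' then (S i).1 c else 0))
          = - (φ' (u ⬝ᵥ (S i).1) * (S i).1 c) := by
        intro i
        rw [Finset.sum_eq_single j]
        · rw [hW i j (by simpa using hj), if_neg hj, if_pos rfl]; ring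
        · intro b _ hb
          rw [if_neg hj, if_neg hb.symm]; ring
        · intro hh; exact absurd (by simpa using hj) hh
      simp only [this, Pi.neg_apply, redG, Finset.sum_neg_distrib]
      ring
    have e : (W - η • gradM (empRisk φ S) W) 0 - (W - η • gradM (empRisk φ S) W) j
        = (W 0 - W j) - η • (gradM (empRisk φ S) W 0 - gradM (empRisk φ S) W j) := by
      funext c; simp; ring
    rw [e, ih j hj, g0, gj]
    funext c; simp; ring

lemma phi_le_of_count {n d : ℕ} (hn : 0 < n) {φ : ℝ → ℝ} (hφ0 : ∀ x, 0 ≤ φ x)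
    (x : Fin n → Fin d → ℝ) (u X : Fin d → ℝ) (b : ℝ) (hF : redF φ x u ≤ b)
    (hc : n ≤ 128 * #{i | x i = X}) : φ (u ⬝ᵥ X) ≤ 128 * b := by
  have hn' : (0 : ℝ) < n := by exact_mod_cast hn
  have hc' : (n : ℝ) ≤ 128 * (#{i | x i = X} : ℕ) := by exact_mod_cast hc
  have h1 : (#{i | x i = X} : ℕ) * φ (u ⬝ᵥ X) ≤ ∑ i, φ (u ⬝ᵥ x i) := by
    rw [← nsmul_eq_mul, ← Finset.sum_const]
    calc _ = ∑ i with x i = X, φ (u ⬝ᵥ x i) := by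
          refine Finset.sum_congr rfl fun i hi => ?_
          rw [(Finset.mem_filter.1 hi).2]
      _ ≤ _ := Finset.sum_le_sum_of_subset_of_nonneg (Finset.filter_subset _ _)
          fun i _ _ => hφ0 _
  rw [redF, one_div, inv_mul_le_iff₀ hn'] at hF
  have h2 : n * φ (u ⬝ᵥ X) ≤ 128 * (#{i | x i = X} : ℕ) * φ (u ⬝ᵥ X) :=
    mul_le_mul_of_nonneg_right hc' (hφ0 _)
  have : n * φ (u ⬝ᵥ X) ≤ n * (128 * b) := by nlinarith
  exact le_of_mul_le_mul_left this hn'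

lemma good_u {k n : ℕ} (hk : 2 ≤ k) (hn : 35 ≤ n)
    (β : ℝ) (hβ : 0 < β) (ρ ρ' : ℝ → ℝ) (hρ : IsTailFunction β ρ ρ')
    (γ : ℝ) (hγ0 : 0 < γ) (hγ : γ ≤ 1 / 8)
    (T : ℕ) (hT : 1 ≤ T)
    (η : ℝ) (hη0 : 0 < η) (hη : η ≤ 1 / (6 * β * k))
    (ε : ℝ) (hε0 : 0 < ε) (hε1 : ε ≤ 1 / 256)
    (hεT : tailInv ρ (ε / k) ^ 2 / (η * γ ^ 2 * T) ≤ ε)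
    (φ φ' : ℝ → ℝ) (hφ : φ = fun x => if 0 ≤ x then ρ x else ρ 0 + ρ' 0 * x + β / 2 * x ^ 2)
    (hg : GoodLoss β φ φ')
    (x : Fin n → Fin 3 → ℝ) (hx : ∀ i, x i = ![1, 0, 0] ∨ x i = ![-(1 / 2), 3 * γ, 0])
    (h1 : n ≤ 128 * #{i | x i = ![1, 0, 0]})
    (h2 : n ≤ 128 * #{i | x i = ![-(1 / 2), 3 * γ, 0]}) :
    redGD φ' x (k * η) (T - 1) 2 = 0 ∧
      tailInv ρ (256 * ε / k) / (3 * γ) ≤ redGD φ' x (k * η) (T - 1) 1 := by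
  have hk' : (2 : ℝ) ≤ k := by exact_mod_cast hk
  have hn0 : 0 < n := by omega
  have hn' : (0 : ℝ) < n := by exact_mod_cast hn0
  have hT2 := two_le_T hk hβ hρ hγ0 hγ hT hη0 hη hε0 hε1 hεT
  refine ⟨redGD_zero _ _ _ (fun i => by rcases hx i with h | h <;> rw [h] <;> rfl) _ _, ?_⟩
  set u := redGD φ' x (k * η) (T - 1) with hu
  set R := tailInv ρ (ε / k) with hR
  have hz : 0 < ε / k := by positivity
  have hR0 : 0 ≤ R := tailInv_nonneg _
  have hRs : ρ R ≤ ε / k := tailInv_spec hρ _ hz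
  have hnorm : ∀ i, x i ⬝ᵥ x i ≤ 1 := by
    intro i
    rcases hx i with h | h <;> rw [h] <;> simp [dotProduct, Fin.sum_univ_three]
    nlinarith
  have hs : (k * η) * β ≤ 1 := by
    rw [le_div_iff₀ (by positivity)] at hη
    nlinarith
  have hconv := redGD_conv hn0 hβ hg x hnorm (k * η) (by positivity) hs
    ![R, R / (2 * γ), 0] (T - 1)
  rw [← hu] at hconv
  have hFv : redF φ x ![R, R / (2 * γ), 0] ≤ ε / k := by
    have : ∀ i, φ (![R, R / (2 * γ), 0] ⬝ᵥ x i) = ρ R := by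
      intro i
      have : ![R, R / (2 * γ), 0] ⬝ᵥ x i = R := by
        rcases hx i with h | h <;> rw [h] <;> simp [dotProduct, Fin.sum_univ_three]
        field_simp
        ring
      rw [this, hφ]
      exact if_pos hR0
    simp only [redF, this, Finset.sum_const, Finset.card_univ, Fintype.card_fin, nsmul_eq_mul]
    rw [← mul_assoc, one_div, inv_mul_cancel₀ hn'.ne', one_mul]
    exact hRs
  have hvv : ![R, R / (2 * γ), 0] ⬝ᵥ ![R, R / (2 * γ), 0] ≤ ε * η * T / 2 := by
    rw [div_le_iff₀ (by positivity)] at hεT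
    have : ![R, R / (2 * γ), 0] ⬝ᵥ ![R, R / (2 * γ), 0] = R ^ 2 * (1 + 4 * γ ^ 2) / (4 * γ ^ 2) := by
      simp [dotProduct, Fin.sum_univ_three]
      field_simp
      ring
    rw [this, div_le_iff₀ (by positivity)]
    have : R ^ 2 * (1 + 4 * γ ^ 2) ≤ R ^ 2 * 2 := by gcongr; nlinarith
    nlinarith
  have hTc : ((T - 1 : ℕ) : ℝ) = T - 1 := by push_cast [Nat.cast_sub hT]; ring
  rw [hTc] at hconv
  have hT2' : (2 : ℝ) ≤ T := by exact_mod_cast hT2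
  have hF : redF φ x u ≤ 2 * ε / k := by
    have h0 : 0 ≤ (u - ![R, R / (2 * γ), 0]) ⬝ᵥ (u - ![R, R / (2 * γ), 0]) := by
      simp only [dotProduct]; exact Finset.sum_nonneg fun i _ => mul_self_nonneg _
    have h3 : 2 * (k * η) * (T - 1 : ℝ) * (redF φ x u - redF φ x ![R, R / (2 * γ), 0])
        ≤ 2 * (k * η) * (T - 1 : ℝ) * (ε / k / 2) := by
      have e : 2 * (k * η) * (T - 1 : ℝ) * (ε / k / 2) = ε * η * (T - 1) := by field_simp
      rw [e]
      have : ε * η * (T / 2) ≤ ε * η * (T - 1) := by gcongr; linarith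
      linarith
    have hp : 0 < 2 * (k * η) * (T - 1 : ℝ) := by
      have : (0:ℝ) < T - 1 := by linarith
      positivity
    have h4 := le_of_mul_le_mul_left h3 hp
    have e : 2 * ε / k = 2 * (ε / k) := by ring
    rw [e]
    linarith
  have hφ0 := phi_nonneg hβ hρ hφ
  have e256 : 128 * (2 * ε / k) = 256 * ε / k := by ring
  have hlt : 256 * ε / k < 1 := by
    rw [div_lt_iff₀ (by positivity)]; linarith
  have a1 := phi_le_of_count hn0 hφ0 x u _ _ hF h1
  have a2 := phi_le_of_count hn0 hφ0 x u _ _ hF h2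
  rw [e256] at a1 a2
  have b1 := (tailInv_le_of_phi hβ hρ hφ _ _ hlt a1).1
  have b2 := (tailInv_le_of_phi hβ hρ hφ _ _ hlt a2).2
  simp [dotProduct, Fin.sum_univ_three] at b1 b2
  rw [div_le_iff₀ (by positivity)]
  linarith

section measure
variable {α : Type*} [MeasurableSpace α] [MeasurableSingletonClass α]

lemma int_three {a b c : ℝ} (ha : 0 ≤ a) (hb : 0 ≤ b) (hc : 0 ≤ c) (X Y Z : α) (f : α → ℝ) :
    ∫ z, f z ∂(ENNReal.ofReal a • Measure.dirac X + ENNReal.ofReal b • Measure.dirac Y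
      + ENNReal.ofReal c • Measure.dirac Z) = a * f X + b * f Y + c * f Z := by
  have hi : ∀ (r : ℝ) (W : α), Integrable f (ENNReal.ofReal r • Measure.dirac W) := fun r W =>
    (integrable_dirac (by simp)).smul_measure ENNReal.ofReal_ne_top
  rw [integral_add_measure ((hi a X).add_measure (hi b Y)) (hi c Z),
    integral_add_measure (hi a X) (hi b Y)]
  simp [integral_smul_measure, ha, hb, hc]

lemma ae_three {a b c : ℝ} (X Y Z : α) :
    ∀ᵐ z ∂(ENNReal.ofReal a • Measure.dirac X + ENNReal.ofReal b • Measure.dirac Y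
      + ENNReal.ofReal c • Measure.dirac Z), z = X ∨ z = Y ∨ z = Z := by
  have h : ∀ (r : ℝ) (W : α), (W = X ∨ W = Y ∨ W = Z) →
      ∀ᵐ z ∂(ENNReal.ofReal r • Measure.dirac W), z = X ∨ z = Y ∨ z = Z := by
    intro r W hW
    refine Measure.ae_smul_measure ?_ _
    rw [ae_dirac_eq]
    exact hW
  rw [ae_add_measure_iff, ae_add_measure_iff]
  exact ⟨⟨h _ _ (by simp), h _ _ (by simp)⟩, h _ _ (by simp)⟩

lemma ae_pi_three {n : ℕ} {D : Measure α} [IsProbabilityMeasure D] {X Y Z : α}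
    (h : ∀ᵐ z ∂D, z = X ∨ z = Y ∨ z = Z) :
    ∀ᵐ ω ∂(Measure.pi fun _ : Fin n => D), ∀ i, ω i = X ∨ ω i = Y ∨ ω i = Z :=
  eventually_all.2 fun i =>
    (Measure.tendsto_eval_ae_ae (μ := fun _ : Fin n => D) (i := i)).eventually h

lemma integrable_pi_three {n : ℕ} {D : Measure α} [IsProbabilityMeasure D] {X Y Z : α}
    (h : ∀ᵐ z ∂D, z = X ∨ z = Y ∨ z = Z) (f : (Fin n → α) → ℝ) :
    Integrable f (Measure.pi fun _ : Fin n => D) := by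
  have hae := ae_pi_three (n := n) h
  have hfin : Set.Finite {ω : Fin n → α | ∀ i, ω i = X ∨ ω i = Y ∨ ω i = Z} := by
    have : Set.Finite {z | z = X ∨ z = Y ∨ z = Z} := by
      have : {z | z = X ∨ z = Y ∨ z = Z} = {X, Y, Z} := by ext; simp
      rw [this]; exact Set.toFinite _
    exact Set.Finite.pi' fun _ => this
  have := IntegrableOn.of_finite (μ := Measure.pi fun _ : Fin n => D) (f := f) hfin
  rw [IntegrableOn, Measure.restrict_eq_self_of_ae_mem
    (s := {ω : Fin n → α | ∀ i, ω i = X ∨ ω i = Y ∨ ω i = Z}) hae] at this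
  exact this

open Classical in
/-- comparison function for one coordinate -/
noncomputable def hfun (Z Y : α) (s : ℝ) (z : α) : ℝ := if z = Z then 0 else if z = Y then s else 1

lemma prod_hfun_zero {n : ℕ} (Z Y : α) (s : ℝ) (ω : Fin n → α) (i : Fin n) (hi : ω i = Z) :
    ∏ i, hfun Z Y s (ω i) = 0 :=
  Finset.prod_eq_zero (Finset.mem_univ i) (by simp [hfun, hi])

open Classical in
lemma prod_hfun {n : ℕ} (Z Y : α) (s : ℝ) (ω : Fin n → α) (hi : ∀ i, ω i ≠ Z) :
    ∏ i, hfun Z Y s (ω i) = s ^ (#{i | ω i = Y}) := by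
  have : ∀ i, hfun Z Y s (ω i) = if ω i = Y then s else 1 := fun i => by simp [hfun, hi i]
  simp only [this, Finset.prod_ite, Finset.prod_const, one_pow, mul_one]

lemma prod_hfun_nonneg {n : ℕ} (Z Y : α) (s : ℝ) (hs : 0 ≤ s) (ω : Fin n → α) :
    0 ≤ ∏ i, hfun Z Y s (ω i) := by
  refine Finset.prod_nonneg fun i _ => ?_
  unfold hfun; split_ifs <;> linarith

lemma one_le_of_count (n m : ℕ) (h : 128 * m ≤ n) : (1 : ℝ) ≤ (51 / 50) ^ n * (1 / 12) ^ m := by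
  have h1 : ((51 : ℝ) / 50) ^ (128 * m) ≤ (51 / 50) ^ n := by
    gcongr; norm_num
  calc (1 : ℝ) ≤ ((51 / 50) ^ 128 * (1 / 12)) ^ m := one_le_pow₀ (by norm_num)
    _ = (51 / 50) ^ (128 * m) * (1 / 12) ^ m := by rw [mul_pow, pow_mul]
    _ ≤ _ := by gcongr

lemma pow_lower (n : ℕ) (hn : 35 ≤ n) : (1 / 8 : ℝ) ≤ (1 - 1 / n) ^ n := by
  have hn' : (35 : ℝ) ≤ n := by exact_mod_cast hn
  have h1 : (0 : ℝ) < 1 - 1 / n := by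
    rw [sub_pos, div_lt_one (by linarith)]; linarith
  have h2 : Real.exp (-(2 / n : ℝ)) ≤ 1 - 1 / n := by
    rw [Real.exp_neg, inv_le_comm₀ (Real.exp_pos _) h1]
    refine le_trans ?_ (Real.add_one_le_exp _)
    rw [inv_le_iff_one_le_mul₀ h1]
    field_simp
    nlinarith
  calc (1 / 8 : ℝ) ≤ Real.exp (-2) := by
        rw [Real.exp_neg, one_div]
        apply inv_anti₀ (Real.exp_pos _)
        have : Real.exp 2 = Real.exp 1 ^ 2 := by rw [← Real.exp_nat_mul]; norm_num
        rw [this]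
        have := Real.exp_one_lt_d9
        have := Real.exp_pos 1
        nlinarith
    _ = Real.exp (-(2 / n : ℝ)) ^ n := by
        rw [← Real.exp_nat_mul]; congr 1; field_simp
    _ ≤ _ := by gcongr

open Classical in
lemma main_prob {n : ℕ} (hn : 35 ≤ n) {D : Measure α} [IsProbabilityMeasure D] {X Y Z : α}
    (hXY : X ≠ Y) (hXZ : X ≠ Z) (hYZ : Y ≠ Z)
    (hD : D = ENNReal.ofReal ((59 / 64) * (1 - 1 / n)) • Measure.dirac X
        + ENNReal.ofReal ((5 / 64) * (1 - 1 / n)) • Measure.dirac Y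
        + ENNReal.ofReal (1 / n) • Measure.dirac Z)
    (f : (Fin n → α) → ℝ) (C : ℝ) (hC : 0 ≤ C)
    (hf0 : ∀ ω, (∀ i, ω i = X ∨ ω i = Y ∨ ω i = Z) → 0 ≤ f ω)
    (hf : ∀ ω : Fin n → α, (∀ i, ω i = X ∨ ω i = Y) → n ≤ 128 * #{i | ω i = X} →
      n ≤ 128 * #{i | ω i = Y} → C ≤ f ω) :
    C / 32 ≤ ∫ ω, f ω ∂(Measure.pi fun _ : Fin n => D) := by
  have hn' : (35 : ℝ) ≤ n := by exact_mod_cast hn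
  have hw : (0 : ℝ) < 1 - 1 / n := by
    rw [sub_pos, div_lt_one (by linarith)]; linarith
  have hae : ∀ᵐ z ∂D, z = X ∨ z = Y ∨ z = Z := by rw [hD]; exact ae_three X Y Z
  have hint : ∀ g : α → ℝ, ∫ z, g z ∂D = (59 / 64) * (1 - 1 / n) * g X
      + (5 / 64) * (1 - 1 / n) * g Y + 1 / n * g Z := by
    intro g
    conv_lhs => rw [hD]
    exact int_three (by positivity) (by positivity) (by positivity) X Y Z g
  set A : ℝ := 51 / 50 with hA
  have hAn : (1 : ℝ) ≤ A ^ n := one_le_pow₀ (by norm_num [hA])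
  set g : (Fin n → α) → ℝ := fun ω => C * (∏ i, hfun Z X 1 (ω i)
    - A ^ n * ∏ i, hfun Z Y (1 / 12) (ω i) - A ^ n * ∏ i, hfun Z X (1 / 12) (ω i)) with hgdef
  have hI := fun f => integrable_pi_three (n := n) hae f
  have hle : ∀ ω, (∀ i, ω i = X ∨ ω i = Y ∨ ω i = Z) → g ω ≤ f ω := by
    intro ω hω
    by_cases hZ : ∃ i, ω i = Z
    · obtain ⟨i, hi⟩ := hZ
      have : g ω = 0 := by
        simp only [hgdef, prod_hfun_zero Z _ _ ω i hi]; ring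
      rw [this]; exact hf0 ω hω
    · push Not at hZ
      have p1 := prod_hfun_nonneg Z Y (1 / 12) (by norm_num) ω
      have p2 := prod_hfun_nonneg Z X (1 / 12) (by norm_num) ω
      have q1 := mul_nonneg (by linarith : (0:ℝ) ≤ A ^ n) p1
      have q2 := mul_nonneg (by linarith : (0:ℝ) ≤ A ^ n) p2
      have p0 := prod_hfun Z X 1 ω hZ
      rw [one_pow] at p0
      have hω' : ∀ i, ω i = X ∨ ω i = Y := fun i => by
        rcases hω i with h | h | h
        · exact Or.inl h
        · exact Or.inr h
        · exact absurd h (hZ i)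
      by_cases h1 : n ≤ 128 * #{i | ω i = X}
      · by_cases h2 : n ≤ 128 * #{i | ω i = Y}
        · refine le_trans ?_ (hf ω hω' h1 h2)
          simp only [hgdef, p0]
          nlinarith
        · refine le_trans ?_ (hf0 ω hω)
          have := one_le_of_count n #{i | ω i = Y} (by omega)
          rw [← prod_hfun Z Y _ ω hZ] at this
          simp only [hgdef, p0]
          nlinarith
      · refine le_trans ?_ (hf0 ω hω)
        have := one_le_of_count n #{i | ω i = X} (by omega)
        rw [← prod_hfun Z X _ ω hZ] at this
        simp only [hgdef, p0]
        nlinarith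
  have hmono : ∫ ω, g ω ∂(Measure.pi fun _ : Fin n => D)
      ≤ ∫ ω, f ω ∂(Measure.pi fun _ : Fin n => D) := by
    refine integral_mono_ae (hI _) (hI _) ?_
    filter_upwards [ae_pi_three hae] with ω hω using hle ω hω
  refine le_trans ?_ hmono
  simp only [hgdef]
  rw [integral_const_mul, integral_sub (hI _) (hI _), integral_sub (hI _) (hI _),
    integral_const_mul, integral_const_mul, integral_fintype_prod_eq_pow,
    integral_fintype_prod_eq_pow, integral_fintype_prod_eq_pow, hint, hint, hint, Fintype.card_fin]
  simp only [hfun, hXY, hXZ, hYZ, hXY.symm, if_true, if_false]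
  set w : ℝ := 1 - 1 / n with hwdef
  have e1 : (59 / 64 * w * 1 + 5 / 64 * w * 1 + 1 / n * 0 : ℝ) = w := by ring
  have e2 : (59 / 64 * w * 1 + 5 / 64 * w * (1 / 12) + 1 / n * 0 : ℝ) = w * (713 / 768) := by ring
  have e3 : (59 / 64 * w * (1 / 12) + 5 / 64 * w * 1 + 1 / n * 0 : ℝ) = w * (119 / 768) := by ring
  rw [e1, e2, e3, mul_pow, mul_pow]
  have k1 : A ^ n * (713 / 768 : ℝ) ^ n ≤ 1 / 2 := by
    rw [← mul_pow]
    calc (A * (713 / 768)) ^ n ≤ (A * (713 / 768)) ^ 35 :=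
          pow_le_pow_of_le_one (by norm_num [hA]) (by norm_num [hA]) hn
      _ ≤ 1 / 2 := by norm_num [hA]
  have k2 : A ^ n * (119 / 768 : ℝ) ^ n ≤ 1 / 4 := by
    rw [← mul_pow]
    calc (A * (119 / 768)) ^ n ≤ (A * (119 / 768)) ^ 35 :=
          pow_le_pow_of_le_one (by norm_num [hA]) (by norm_num [hA]) hn
      _ ≤ 1 / 4 := by norm_num [hA]
  have k3 := pow_lower n hn
  rw [← hwdef] at k3
  have k4 : w ^ n * (1 / 4) ≤ w ^ n * (1 - A ^ n * (713 / 768 : ℝ) ^ n - A ^ n * (119 / 768) ^ n) := by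
    gcongr; linarith
  have k5 : (1 / 32 : ℝ) ≤ w ^ n - A ^ n * (w ^ n * (713 / 768) ^ n)
      - A ^ n * (w ^ n * (119 / 768) ^ n) := by nlinarith
  calc C / 32 = C * (1 / 32) := by ring
    _ ≤ _ := by gcongr

end measure

/-- lower bound `Ω(β k ρ⁻¹(256ε/k)²/(γ²n))` on the expected population risk of
the `T`-th GD iterate, for the three-point hard distribution and the quadratically-extended tail
loss. -/
theorem statement18 {k n : ℕ} [NeZero k] (hk : 2 ≤ k) (hn : 35 ≤ n)
    (β : ℝ) (hβ : 0 < β) (ρ ρ' : ℝ → ℝ) (hρ : IsTailFunction β ρ ρ')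
    (γ : ℝ) (hγ0 : 0 < γ) (hγ : γ ≤ 1 / 8)
    (T : ℕ) (hT : 1 ≤ T)
    (η : ℝ) (hη0 : 0 < η) (hη : η ≤ 1 / (6 * β * k))
    (ε : ℝ) (hε0 : 0 < ε) (hε1 : ε ≤ 1 / 256)
    (hεT : tailInv ρ (ε / k) ^ 2 / (η * γ ^ 2 * T) ≤ ε)
    (φ : ℝ → ℝ) (hφ : φ = fun x => if 0 ≤ x then ρ x else ρ 0 + ρ' 0 * x + β / 2 * x ^ 2)
    (D : Measure ((Fin 3 → ℝ) × Fin k)) [IsProbabilityMeasure D]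
    (hD : D = ENNReal.ofReal ((59 / 64) * (1 - 1 / n)) • Measure.dirac (![1, 0, 0], 0)
        + ENNReal.ofReal ((5 / 64) * (1 - 1 / n)) • Measure.dirac (![-(1 / 2), 3 * γ, 0], 0)
        + ENNReal.ofReal (1 / n) • Measure.dirac (![0, -(1 / 8), 4 * γ + 1 / 4], 0)) :
    β * k * tailInv ρ (256 * ε / k) ^ 2 / (10 ^ 6 * γ ^ 2 * n) ≤
      ∫ ω : Fin n → (Fin 3 → ℝ) × Fin k,
        (∫ z, mcLoss φ (fun r => ∑ t, gdFrom η (empRisk φ ω) (T - 1) r t * z.1 t) z.2 ∂D)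
        ∂(Measure.pi fun _ : Fin n => D) := by
  have hg := goodLoss_of_tail hβ hρ hφ
  set φ' : ℝ → ℝ := fun x => if 0 ≤ x then ρ' x else ρ' 0 + β * x
  have hφ0 := phi_nonneg hβ hρ hφ
  have hk' : (2 : ℝ) ≤ k := by exact_mod_cast hk
  have hn' : (35 : ℝ) ≤ n := by exact_mod_cast hn
  have hw : (0 : ℝ) < 1 - 1 / n := by
    rw [sub_pos, div_lt_one (by linarith)]; linarith
  have hloss0 : ∀ (v : Fin k → ℝ) (y : Fin k), 0 ≤ mcLoss φ v y := fun v y =>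
    Finset.sum_nonneg fun _ _ => hφ0 _
  have hXY : ((![1, 0, 0], 0) : (Fin 3 → ℝ) × Fin k) ≠ (![-(1 / 2), 3 * γ, 0], 0) := by
    intro h
    have := congrFun (congrArg Prod.fst h) 0
    norm_num at this
  have hXZ : ((![1, 0, 0], 0) : (Fin 3 → ℝ) × Fin k) ≠ (![0, -(1 / 8), 4 * γ + 1 / 4], 0) := by
    intro h
    have := congrFun (congrArg Prod.fst h) 0
    norm_num at this
  have hYZ : ((![-(1 / 2), 3 * γ, 0], 0) : (Fin 3 → ℝ) × Fin k)
      ≠ (![0, -(1 / 8), 4 * γ + 1 / 4], 0) := by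
    intro h
    have := congrFun (congrArg Prod.fst h) 0
    norm_num at this
  set R := tailInv ρ (256 * ε / k) with hR
  have hR0 : 0 ≤ R := tailInv_nonneg _
  set C : ℝ := β * k * R ^ 2 / (2304 * γ ^ 2 * n) with hC
  have hC0 : 0 ≤ C := by positivity
  have hfin : β * k * R ^ 2 / (10 ^ 6 * γ ^ 2 * n) ≤ C / 32 := by
    have e : C / 32 = β * k * R ^ 2 / (73728 * γ ^ 2 * n) := by
      rw [hC]; field_simp; ring
    rw [e]
    gcongr
    norm_num
  refine hfin.trans ?_
  refine main_prob hn hXY hXZ hYZ hD _ C hC0 ?_ ?_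
  · intro ω _
    exact integral_nonneg fun z => hloss0 _ _
  · intro ω hω h1 h2
    have hS : ∀ i, (ω i).2 = 0 := fun i => by rcases hω i with h | h <;> rw [h]
    have hiff : ∀ (i : Fin n) (X : Fin 3 → ℝ), (ω i).1 = X ↔ ω i = (X, 0) := by
      intro i X
      constructor
      · intro h; exact Prod.ext h (hS i)
      · intro h; rw [h]
    have hgood := good_u hk hn β hβ ρ ρ' hρ γ hγ0 hγ T hT η hη0 hη ε hε0 hε1 hεT φ φ' hφ hg
      (fun i => (ω i).1)
      (fun i => by
        rcases hω i with h | h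
        · left; rw [h]
        · right; rw [h])
      (by convert h1 using 4; exact hiff _ _)
      (by convert h2 using 4; exact hiff _ _)
    have hred := gd_reduce hg ω hS η (T - 1)
    set u := redGD φ' (fun i => (ω i).1) (k * η) (T - 1)
    set W := gdFrom η (empRisk φ ω) (T - 1)
    obtain ⟨hu2, hu1⟩ := hgood
    conv_rhs => rw [hD]
    rw [int_three (by positivity) (by positivity) (by positivity)]
    have hx3 : mcLoss φ (fun r => ∑ t, W r t * ![0, -(1 / 8), 4 * γ + 1 / 4] t) 0
        = (k - 1 : ℝ) * φ (-(1 / 8) * u 1) := by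
      have hcard : ((Finset.univ \ {0} : Finset (Fin k)).card : ℝ) = k - 1 := by
        rw [Finset.card_sdiff_of_subset (by simp)]
        have : 1 ≤ k := by omega
        simp [Nat.cast_sub this]
      rw [← hcard, ← nsmul_eq_mul, ← Finset.sum_const, mcLoss]
      refine Finset.sum_congr rfl fun j hj => ?_
      congr 1
      have := hred j (by simpa using hj)
      have t1 := congrFun this 1
      have t2 := congrFun this 2
      rw [hu2] at t2
      rw [← t1]
      simp only [Pi.sub_apply] at t2 ⊢
      have e : W 0 2 = W j 2 := by linarith
      simp [Fin.sum_univ_three, e]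
      ring
    have hu0 : 0 ≤ u 1 := le_trans (by positivity) hu1
    have hphi := phi_neg hβ hρ hφ (-(1 / 8) * u 1) (by linarith)
    have hsq : (R / (3 * γ)) ^ 2 ≤ u 1 ^ 2 := by gcongr
    have hb : β * R ^ 2 / (1152 * γ ^ 2) ≤ φ (-(1 / 8) * u 1) := by
      have e : β * R ^ 2 / (1152 * γ ^ 2) = β / 128 * (R / (3 * γ)) ^ 2 := by field_simp; ring
      rw [e]
      have : β / 128 * (R / (3 * γ)) ^ 2 ≤ β / 128 * u 1 ^ 2 := by gcongr
      linarith
    have hk1 : (k / 2 : ℝ) ≤ k - 1 := by linarith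
    have hterm : C ≤ 1 / n * mcLoss φ (fun r => ∑ t, W r t * ![0, -(1 / 8), 4 * γ + 1 / 4] t) 0 := by
      rw [hx3]
      calc C = 1 / n * (k / 2 * (β * R ^ 2 / (1152 * γ ^ 2))) := by
            rw [hC]; field_simp; ring
        _ ≤ _ := by gcongr; linarith
    refine hterm.trans ?_
    have a1 := mul_nonneg (by positivity : (0:ℝ) ≤ 59 / 64 * (1 - 1 / n))
      (hloss0 (fun r => ∑ t, W r t * ![1, 0, 0] t) 0)
    have a2 := mul_nonneg (by positivity : (0:ℝ) ≤ 5 / 64 * (1 - 1 / n))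
      (hloss0 (fun r => ∑ t, W r t * ![-(1 / 2), 3 * γ, 0] t) 0)
    linarith
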